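/- Let p, q ∈ ℝ^m be probability distributions with p↓ ≠ q↓, and suppose there exist k ∈ ℕ₀ and a k-partite probability distribution r_{1,…,k} with marginals r_1,…,r_k such that p ⊗ (r_1 ⊗ … ⊗ r_k) ≻ q ⊗ r_{1,…,k}. Then rank(p) ≤ rank(q) and H(p) < H(q). -/

import Mathlib

open scoped BigOperators

/-- `p` is a probability distribution on the finite type `ι`. -/
def IsProbDist {ι : Type*} [Fintype ι] (p : ι → ℝ) : Prop :=
  (∀ i, 0 ≤ p i) ∧ ∑ i, p i = 1

/-- `p` is a probability distribution with strictly positive entries. -/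
def IsPosProbDist {ι : Type*} [Fintype ι] (p : ι → ℝ) : Prop :=
  (∀ i, 0 < p i) ∧ ∑ i, p i = 1

/-- `p` majorizes `q`: for every `k`, the sum of the `k` largest entries of `p` is at least
the sum of the `k` largest entries of `q`.  For nonnegative vectors this is equivalent to:
for every set `A` of indices of `q` there is a set `B` of indices of `p` with `|B| ≤ |A|`
whose `p`-sum dominates the `q`-sum over `A`. -/
def Majorizes {ι κ : Type*} [Fintype ι] [Fintype κ] (p : ι → ℝ) (q : κ → ℝ) : Prop :=
  ∀ A : Finset κ, ∃ B : Finset ι, B.card ≤ A.card ∧ ∑ j ∈ A, q j ≤ ∑ i ∈ B, p i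

/-- Kronecker (tensor) product of two vectors. -/
def kron {ι κ : Type*} (p : ι → ℝ) (q : κ → ℝ) : ι × κ → ℝ :=
  fun x => p x.1 * q x.2

/-- Shannon entropy (natural logarithm; note `Real.log 0 = 0`, so `0 log 0 = 0`). -/
noncomputable def shannonEntropy {ι : Type*} [Fintype ι] (p : ι → ℝ) : ℝ :=
  -∑ i, p i * Real.log (p i)

open Classical in
/-- The number of nonzero entries of `p`. -/
noncomputable def distRank {ι : Type*} [Fintype ι] (p : ι → ℝ) : ℕ :=
  (Finset.univ.filter fun i => p i ≠ 0).card

/-- Marginal of a `k`-partite distribution on its `i`-th factor. -/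
noncomputable def marginal {k : ℕ} {d : Fin k → ℕ} (r : (∀ i, Fin (d i)) → ℝ) (i : Fin k) :
    Fin (d i) → ℝ :=
  fun b => ∑ y : ∀ j, Fin (d j), if y i = b then r y else 0

open Classical in
/-- Rényi entropy of order `α` (with `H₁` being the Shannon entropy). -/
noncomputable def renyi {ι : Type*} [Fintype ι] (α : ℝ) (p : ι → ℝ) : ℝ :=
  if α = 1 then shannonEntropy p
  else (Real.sign α / (1 - α)) * Real.log (∑ i, p i ^ α)

/-- Min-entropy `H_∞(p) = -log (max_i p_i)`. -/
noncomputable def renyiInf {ι : Type*} [Fintype ι] (p : ι → ℝ) : ℝ :=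
  -Real.log (⨆ i, p i)

/-- Burg entropy `H_Burg(p) = (1/m) ∑ log p_i`. -/
noncomputable def burg {ι : Type*} [Fintype ι] (p : ι → ℝ) : ℝ :=
  (1 / (Fintype.card ι : ℝ)) * ∑ i, Real.log (p i)

open Classical in
/-- Rényi entropy as an extended real: it is `-∞` for `α < 0` when `p` has a zero entry. -/
noncomputable def renyiE {ι : Type*} [Fintype ι] (α : ℝ) (p : ι → ℝ) : EReal :=
  if α < 0 ∧ ∃ i, p i = 0 then ⊥ else (renyi α p : EReal)

open Classical in
/-- Burg entropy as an extended real: it is `-∞` when `p` has a zero entry. -/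
noncomputable def burgE {ι : Type*} [Fintype ι] (p : ι → ℝ) : EReal :=
  if ∃ i, p i = 0 then ⊥ else (burg p : EReal)

/-- `p` trumps `q`: there is a catalyst distribution `r` with `p ⊗ r ≻ q ⊗ r`. -/
def Trumps {ι κ : Type*} [Fintype ι] [Fintype κ] (p : ι → ℝ) (q : κ → ℝ) : Prop :=
  ∃ (n : ℕ) (r : Fin n → ℝ), IsProbDist r ∧ Majorizes (kron p r) (kron q r)

/-- The bipartite extension `q_{AB}` of `q` with parameters `a i ∈ [0, q i]` and `n`:
the `m × (n+1)` matrix whose first column is `(q i - a i)` and whose remaining `n`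
columns all equal `(a i / n)`. -/
noncomputable def qAB {m : ℕ} (q a : Fin m → ℝ) (n : ℕ) : Fin m × Fin (n + 1) → ℝ :=
  fun x => if x.2 = 0 then q x.1 - a x.1 else a x.1 / n

/-- The `B`-marginal `(1 - a, a/n, …, a/n)` of `qAB`, where `a = ∑ i, a i`. -/
noncomputable def qBext {m : ℕ} (a : Fin m → ℝ) (n : ℕ) : Fin (n + 1) → ℝ :=
  fun j => if j = 0 then 1 - ∑ i, a i else (∑ i, a i) / n

/-- Symmetry of an entropy-like functional on positive distributions. -/
def SymmetricS (S : ∀ n : ℕ, (Fin n → ℝ) → ℝ) : Prop :=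
  ∀ (n : ℕ) (p : Fin n → ℝ), IsPosProbDist p →
    ∀ σ : Equiv.Perm (Fin n), S n (p ∘ σ) = S n p

/-- Additivity: `S(p ⊗ q) = S(p) + S(q)`. -/
def AdditiveS (S : ∀ n : ℕ, (Fin n → ℝ) → ℝ) : Prop :=
  ∀ (m n : ℕ) (p : Fin m → ℝ) (q : Fin n → ℝ), IsPosProbDist p → IsPosProbDist q →
    S (m * n) (fun x => kron p q (finProdFinEquiv.symm x)) = S m p + S n q

/-- Subadditivity: `S(p_{AB}) ≤ S(p_A ⊗ p_B)` for bipartite distributions. -/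
def SubadditiveS (S : ∀ n : ℕ, (Fin n → ℝ) → ℝ) : Prop :=
  ∀ (m n : ℕ) (P : Fin m × Fin n → ℝ), IsPosProbDist P →
    S (m * n) (fun x => P (finProdFinEquiv.symm x)) ≤
      S (m * n) (fun x =>
        kron (fun i => ∑ j, P (i, j)) (fun j => ∑ i, P (i, j)) (finProdFinEquiv.symm x))

/-- Continuity of `S` on each simplex of positive distributions. -/
def ContinuousS (S : ∀ n : ℕ, (Fin n → ℝ) → ℝ) : Prop :=
  ∀ n : ℕ, ContinuousOn (S n) {p : Fin n → ℝ | IsPosProbDist p}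

open Classical in
lemma aux_gibbs {ι : Type*} [Fintype ι] (P Q : ι → ℝ) (hP : IsProbDist P) (hQ : IsProbDist Q)
    (hs : ∀ i, Q i = 0 → P i = 0) :
    ∑ i, P i * Real.log (Q i) ≤ ∑ i, P i * Real.log (P i) ∧
    (∑ i, P i * Real.log (P i) ≤ ∑ i, P i * Real.log (Q i) → P = Q) := by
  have key : ∀ i, 0 ≤ P i * Real.log (P i) - P i * Real.log (Q i) - (P i - Q i) ∧
      (P i * Real.log (P i) - P i * Real.log (Q i) - (P i - Q i) = 0 → P i = Q i) := by
    intro i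
    rcases (hP.1 i).eq_or_lt with h0 | hpos
    · rw [← h0]
      have := hQ.1 i
      constructor
      · simp [this]
      · intro h; simp at h; exact h.symm
    · have hQpos : 0 < Q i := lt_of_le_of_ne (hQ.1 i) (fun h => hpos.ne' (hs i h.symm))
      have hdiv : 0 < Q i / P i := div_pos hQpos hpos
      have hlog : Real.log (Q i / P i) = Real.log (Q i) - Real.log (P i) :=
        Real.log_div hQpos.ne' hpos.ne'
      have e : P i * Real.log (P i) - P i * Real.log (Q i) - (P i - Q i)
          = P i * ((Q i / P i - 1) - Real.log (Q i / P i)) := by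
        rw [hlog]; field_simp; ring
      rw [e]
      constructor
      · exact mul_nonneg hpos.le (sub_nonneg.2 (Real.log_le_sub_one_of_pos hdiv))
      · intro h
        by_contra hne
        have h1 : Q i / P i ≠ 1 := by
          intro h1; rw [div_eq_one_iff_eq hpos.ne'] at h1; exact hne h1.symm
        have := Real.log_lt_sub_one_of_pos hdiv h1
        have := mul_pos hpos (sub_pos.2 this)
        linarith
  have hsum : ∑ i, (P i * Real.log (P i) - P i * Real.log (Q i) - (P i - Q i))
      = ∑ i, P i * Real.log (P i) - ∑ i, P i * Real.log (Q i) := by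
    simp only [Finset.sum_sub_distrib, hP.2, hQ.2]; ring
  have hnn := Finset.sum_nonneg (s := Finset.univ) (fun i _ => (key i).1)
  constructor
  · linarith
  · intro h
    have h0 : ∑ i, (P i * Real.log (P i) - P i * Real.log (Q i) - (P i - Q i)) = 0 := by linarith
    rw [Finset.sum_eq_zero_iff_of_nonneg (fun i _ => (key i).1)] at h0
    funext i
    exact (key i).2 (h0 i (Finset.mem_univ i))

lemma aux_abel : ∀ (n : ℕ) (g D : Fin n → ℝ) (_ : Antitone g)
    (_ : ∀ k : ℕ, 0 ≤ ∑ i, if i.val < k then D i else 0) (c : ℝ) (_ : ∀ i, c ≤ g i),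
    c * ∑ i, D i ≤ ∑ i, g i * D i := by
  intro n
  induction n with
  | zero => intros; simp
  | succ n ih =>
    intro g D hg hD c hc
    have h := ih (fun i => g i.castSucc) (fun i => D i.castSucc)
      (fun i j hij => hg (by simpa using hij))
      (by
        intro k
        have := hD (min k n)
        rw [Fin.sum_univ_castSucc] at this
        simpa using this)
      (g (Fin.last n)) (fun i => hg (Fin.le_last _))
    have hS : 0 ≤ ∑ i, D i := by
      have := hD (n + 1)
      simpa only [Fin.is_lt, if_true] using this
    have h2 := mul_le_mul_of_nonneg_right (hc (Fin.last n)) hS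
    refine h2.trans ?_
    rw [Fin.sum_univ_castSucc, Fin.sum_univ_castSucc, mul_add]
    linarith

lemma aux_sort {ι : Type*} [Fintype ι] (P : ι → ℝ) :
    ∃ e : Fin (Fintype.card ι) ≃ ι, Antitone (P ∘ e) := by
  let f : Fin (Fintype.card ι) → ℝ := fun i => - P ((Fintype.equivFin ι).symm i)
  refine ⟨(Tuple.sort f).trans (Fintype.equivFin ι).symm, ?_⟩
  have := Tuple.monotone_sort f
  intro i j hij
  have := this hij
  simp only [f, Function.comp] at this
  simp only [Function.comp, Equiv.trans_apply]
  linarith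

open Classical in
lemma aux_partial {n : ℕ} (P Q : Fin n → ℝ) (hP : Antitone P) (hP0 : ∀ i, 0 ≤ P i)
    (h : Majorizes P Q) (k : ℕ) :
    0 ≤ ∑ i, if i.val < k then (P i - Q i) else 0 := by
  rw [← Finset.sum_filter, Finset.sum_sub_distrib]
  set A : Finset (Fin n) := Finset.univ.filter (fun i => i.val < k) with hA
  obtain ⟨B, hB, hBs⟩ := h A
  suffices ∑ i ∈ B, P i ≤ ∑ i ∈ A, P i by linarith
  by_cases hk : k < n
  · have ht := hP0 ⟨k, hk⟩
    set t := P ⟨k, hk⟩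
    have h1 : ∑ i ∈ B, (P i - t) ≤ ∑ i ∈ A, (P i - t) := by
      rw [← Finset.sum_filter_add_sum_filter_not B (fun i => i.val < k)]
      have h2 : ∑ i ∈ B.filter (fun i => ¬ i.val < k), (P i - t) ≤ 0 := by
        apply Finset.sum_nonpos
        intro i hi
        have : k ≤ i.val := by simpa using (Finset.mem_filter.1 hi).2
        have : P i ≤ t := hP (show (⟨k, hk⟩ : Fin n) ≤ i from this)
        linarith
      have h3 : ∑ i ∈ B.filter (fun i => i.val < k), (P i - t) ≤ ∑ i ∈ A, (P i - t) := by
        apply Finset.sum_le_sum_of_subset_of_nonneg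
        · intro i hi
          simp only [hA, Finset.mem_filter, Finset.mem_univ, true_and]
          exact (Finset.mem_filter.1 hi).2
        · intro i hi _
          have hi' : i.val < k := by simpa [hA] using hi
          have : t ≤ P i := hP (show i ≤ (⟨k, hk⟩ : Fin n) from hi'.le)
          linarith
      linarith
    have h4 : (B.card : ℝ) * t ≤ A.card * t :=
      mul_le_mul_of_nonneg_right (by exact_mod_cast hB) ht
    simp only [Finset.sum_sub_distrib, Finset.sum_const, nsmul_eq_mul] at h1
    linarith
  · have : A = Finset.univ := by
      ext i; simp [hA]; omega
    rw [this]
    exact Finset.sum_le_sum_of_subset_of_nonneg (Finset.subset_univ _) (fun i _ _ => hP0 i)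

lemma aux_maj_equiv {ι κ ι' κ' : Type*} [Fintype ι] [Fintype κ] [Fintype ι'] [Fintype κ']
    (P : ι → ℝ) (Q : κ → ℝ) (e : ι' ≃ ι) (e' : κ' ≃ κ) (h : Majorizes P Q) :
    Majorizes (P ∘ e) (Q ∘ e') := by
  intro A
  obtain ⟨B, hB, hs⟩ := h (A.map e'.toEmbedding)
  refine ⟨B.map e.symm.toEmbedding, by simpa using hB, ?_⟩
  simpa using hs

open Classical in
lemma aux_supp {ι κ : Type*} [Fintype ι] [Fintype κ] (P : ι → ℝ) (Q : κ → ℝ)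
    (hP : IsProbDist P) (hQ : IsProbDist Q) (h : Majorizes P Q) : distRank P ≤ distRank Q := by
  unfold distRank
  obtain ⟨B, hB, hs⟩ := h (Finset.univ.filter fun i => Q i ≠ 0)
  refine le_trans (Finset.card_le_card ?_) hB
  rw [Finset.sum_filter_ne_zero, hQ.2, ← hP.2, ← Finset.sum_add_sum_compl B] at hs
  have h0 : ∑ i ∈ Bᶜ, P i = 0 :=
    le_antisymm (by linarith) (Finset.sum_nonneg fun i _ => hP.1 i)
  rw [Finset.sum_eq_zero_iff_of_nonneg (fun i _ => hP.1 i)] at h0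
  intro i hi
  by_contra hn
  exact (Finset.mem_filter.1 hi).2 (h0 i (by simpa using hn))

open Classical in
lemma aux_dist_equiv {ι κ : Type*} [Fintype ι] [Fintype κ] (P : ι → ℝ)
    (e : κ ≃ ι) (h : IsProbDist P) : IsProbDist (P ∘ e) :=
  ⟨fun i => h.1 _, by rw [← h.2]; exact Equiv.sum_comp e P⟩

open Classical in
lemma aux_maj_sorted {n : ℕ} (P Q : Fin n → ℝ) (hP : IsProbDist P) (hQ : IsProbDist Q)
    (hPa : Antitone P) (hQa : Antitone Q) (h : Majorizes P Q) :
    ∑ i, Q i * Real.log (Q i) ≤ ∑ i, P i * Real.log (P i) ∧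
    (∑ i, P i * Real.log (P i) ≤ ∑ i, Q i * Real.log (Q i) → P = Q) := by
  have hs : ∀ i, Q i = 0 → P i = 0 := by
    intro i hi
    have hpart := aux_partial P Q hPa hP.1 h i.val
    rw [← Finset.sum_filter, Finset.sum_sub_distrib] at hpart
    have hq : ∑ j ∈ Finset.univ.filter (fun j : Fin n => j.val < i.val), Q j = 1 := by
      rw [← hQ.2]
      apply Finset.sum_subset (Finset.subset_univ _)
      intro j _ hj
      have hij : i ≤ j := by
        simpa using hj
      exact le_antisymm (hi ▸ hQa hij) (hQ.1 j)
    have hp1 := hP.2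
    rw [← Finset.sum_filter_add_sum_filter_not Finset.univ (fun j : Fin n => j.val < i.val)] at hp1
    have h0 : ∑ j ∈ Finset.univ.filter (fun j : Fin n => ¬ j.val < i.val), P j = 0 :=
      le_antisymm (by linarith) (Finset.sum_nonneg fun i _ => hP.1 i)
    rw [Finset.sum_eq_zero_iff_of_nonneg (fun i _ => hP.1 i)] at h0
    exact h0 i (by simp)
  obtain ⟨g1, g2⟩ := aux_gibbs P Q hP hQ hs
  obtain ⟨ε, hε, hεQ⟩ : ∃ ε : ℝ, 0 < ε ∧ ∀ i, Q i ≠ 0 → ε ≤ Q i := by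
    by_cases hne : (Finset.univ.filter fun i => Q i ≠ 0).Nonempty
    · obtain ⟨i, hi, hmin⟩ := Finset.exists_min_image _ Q hne
      refine ⟨Q i, lt_of_le_of_ne (hQ.1 i) (Ne.symm (Finset.mem_filter.1 hi).2), fun j hj => ?_⟩
      exact hmin j (by simp [hj])
    · refine ⟨1, one_pos, fun i hi => absurd ⟨i, by simp [hi]⟩ hne⟩
  have hab := aux_abel n (fun i => Real.log (max (Q i) ε)) (fun i => P i - Q i)
    (fun i j hij => Real.log_le_log (lt_max_of_lt_right hε) (max_le_max (hQa hij) le_rfl))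
    (aux_partial P Q hPa hP.1 h) (Real.log ε)
    (fun i => Real.log_le_log hε (le_max_right _ _))
  have e1 : ∑ i, Real.log (max (Q i) ε) * (P i - Q i)
      = ∑ i, P i * Real.log (Q i) - ∑ i, Q i * Real.log (Q i) := by
    rw [← Finset.sum_sub_distrib]
    refine Finset.sum_congr rfl fun i _ => ?_
    by_cases hi : Q i = 0
    · simp [hi, hs i hi]
    · rw [max_eq_left (hεQ i hi)]; ring
  rw [e1, Finset.sum_sub_distrib, hP.2, hQ.2] at hab
  refine ⟨by linarith, fun hle => g2 (by linarith)⟩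

lemma aux_maj {ι : Type*} [Fintype ι] (P Q : ι → ℝ) (hP : IsProbDist P) (hQ : IsProbDist Q)
    (h : Majorizes P Q) :
    ∑ i, Q i * Real.log (Q i) ≤ ∑ i, P i * Real.log (P i) ∧
    (∑ i, P i * Real.log (P i) ≤ ∑ i, Q i * Real.log (Q i) →
      ∃ σ : Equiv.Perm ι, P = Q ∘ σ) := by
  obtain ⟨e, he⟩ := aux_sort P
  obtain ⟨e', he'⟩ := aux_sort Q
  obtain ⟨h1, h2⟩ := aux_maj_sorted (P ∘ e) (Q ∘ e') (aux_dist_equiv P e hP)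
    (aux_dist_equiv Q e' hQ) he he' (aux_maj_equiv P Q e e' h)
  have s1 : ∑ i, (P ∘ e) i * Real.log ((P ∘ e) i) = ∑ i, P i * Real.log (P i) :=
    Equiv.sum_comp e (fun i => P i * Real.log (P i))
  have s2 : ∑ i, (Q ∘ e') i * Real.log ((Q ∘ e') i) = ∑ i, Q i * Real.log (Q i) :=
    Equiv.sum_comp e' (fun i => Q i * Real.log (Q i))
  rw [s1, s2] at h1 h2
  refine ⟨h1, fun hle => ⟨e.symm.trans e', ?_⟩⟩
  have := h2 hle
  funext x
  have := congrFun this (e.symm x)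
  simpa using this

open Classical in
lemma aux_powers {m : ℕ} (p q : Fin m → ℝ) (h : ∀ s : ℕ, ∑ i, p i ^ s = ∑ i, q i ^ s) :
    ∃ σ : Equiv.Perm (Fin m), p = q ∘ σ := by
  have hpoly : ∀ f : Polynomial ℝ, ∑ i, f.eval (p i) = ∑ i, f.eval (q i) := by
    intro f
    simp only [Polynomial.eval_eq_sum_range]
    rw [Finset.sum_comm, Finset.sum_comm (s := Finset.univ)]
    refine Finset.sum_congr rfl fun s _ => ?_
    rw [← Finset.mul_sum, ← Finset.mul_sum, h s]
  have hcard : ∀ c, Fintype.card {i // p i = c} = Fintype.card {i // q i = c} := by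
    intro c
    let S : Finset ℝ := (Finset.univ.image p ∪ Finset.univ.image q).erase c
    let f : Polynomial ℝ := ∏ v ∈ S, (Polynomial.X - Polynomial.C v)
    have hfc : f.eval c ≠ 0 := by
      simp only [f, Polynomial.eval_prod, Finset.prod_ne_zero_iff]
      intro v hv
      have := (Finset.mem_erase.1 hv).1
      simpa [sub_eq_zero] using this.symm
    have hf0 : ∀ v ∈ S, f.eval v = 0 := by
      intro v hv
      simp only [f, Polynomial.eval_prod]
      exact Finset.prod_eq_zero hv (by simp)
    have hp' : ∀ i, f.eval (p i) = if p i = c then f.eval c else 0 := by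
      intro i
      split_ifs with hi
      · rw [hi]
      · exact hf0 _ (by simp [S, hi])
    have hq' : ∀ i, f.eval (q i) = if q i = c then f.eval c else 0 := by
      intro i
      split_ifs with hi
      · rw [hi]
      · exact hf0 _ (by simp [S, hi])
    have := hpoly f
    simp only [hp', hq', ← Finset.sum_filter, Finset.sum_const, nsmul_eq_mul] at this
    have := mul_right_cancel₀ hfc this
    rw [Fintype.card_subtype, Fintype.card_subtype]
    exact_mod_cast this
  let E := Equiv.ofFiberEquiv (f := p) (g := q) (fun c => Fintype.equivOfCardEq (hcard c))
  exact ⟨E, funext fun i => (Equiv.ofFiberEquiv_map _ i).symm⟩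

open Classical in
lemma aux_kron_dist {ι κ : Type*} [Fintype ι] [Fintype κ] (p : ι → ℝ) (q : κ → ℝ)
    (hp : IsProbDist p) (hq : IsProbDist q) : IsProbDist (kron p q) := by
  refine ⟨fun x => mul_nonneg (hp.1 _) (hq.1 _), ?_⟩
  simp only [kron, Fintype.sum_prod_type, ← Finset.mul_sum, hq.2, mul_one, hp.2]

lemma aux_kron_ent {ι κ : Type*} [Fintype ι] [Fintype κ] (p : ι → ℝ) (q : κ → ℝ)
    (hp : IsProbDist p) (hq : IsProbDist q) :
    ∑ x, kron p q x * Real.log (kron p q x)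
      = ∑ i, p i * Real.log (p i) + ∑ i, q i * Real.log (q i) := by
  have : ∀ x, kron p q x * Real.log (kron p q x)
      = p x.1 * Real.log (p x.1) * q x.2 + p x.1 * (q x.2 * Real.log (q x.2)) := by
    intro x
    simp only [kron]
    by_cases h1 : p x.1 = 0
    · simp [h1]
    by_cases h2 : q x.2 = 0
    · simp [h2]
    rw [Real.log_mul h1 h2]; ring
  simp only [this, Fintype.sum_prod_type, Finset.sum_add_distrib, ← Finset.mul_sum, hq.2,
    ← Finset.sum_mul, hp.2, mul_one, one_mul]

open Classical in
lemma aux_kron_rank {ι κ : Type*} [Fintype ι] [Fintype κ] (p : ι → ℝ) (q : κ → ℝ) :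
    distRank (kron p q) = distRank p * distRank q := by
  unfold distRank
  rw [← Finset.card_product]
  congr 1
  ext x
  simp [kron]

section
variable {k : ℕ} {d : Fin k → ℕ}

lemma aux_marg_nonneg (r : (∀ i, Fin (d i)) → ℝ) (hr : IsProbDist r) (i : Fin k) (b : Fin (d i)) :
    0 ≤ marginal r i b :=
  Finset.sum_nonneg fun y _ => by split_ifs; exacts [hr.1 y, le_rfl]

lemma aux_marg_mul (r : (∀ i, Fin (d i)) → ℝ) (i : Fin k) (g : Fin (d i) → ℝ) :
    ∑ b, marginal r i b * g b = ∑ y, r y * g (y i) := by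
  simp only [marginal, Finset.sum_mul]
  rw [Finset.sum_comm]
  refine Finset.sum_congr rfl fun y _ => ?_
  simp [ite_mul]

lemma aux_marg_sum (r : (∀ i, Fin (d i)) → ℝ) (hr : IsProbDist r) (i : Fin k) :
    ∑ b, marginal r i b = 1 := by
  have := aux_marg_mul r i (fun _ => 1)
  simpa [hr.2] using this

lemma aux_marg_prod (g : ∀ i, Fin (d i) → ℝ) (hg : ∀ i, ∑ b, g i b = 1) (i : Fin k) :
    marginal (fun y : ∀ i, Fin (d i) => ∏ i, g i (y i)) i = g i := by
  funext b
  unfold marginal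
  let G : ∀ j, Fin (d j) → ℝ := Function.update g i (fun c => if c = b then g i c else 0)
  have h1 : ∀ y : ∀ j, Fin (d j), (if y i = b then ∏ j, g j (y j) else 0) = ∏ j, G j (y j) := by
    intro y
    rw [← Finset.mul_prod_erase Finset.univ (fun j => G j (y j)) (Finset.mem_univ i),
      ← Finset.mul_prod_erase Finset.univ (fun j => g j (y j)) (Finset.mem_univ i)]
    have h2 : ∏ j ∈ Finset.univ.erase i, G j (y j) = ∏ j ∈ Finset.univ.erase i, g j (y j) := by
      refine Finset.prod_congr rfl fun j hj => ?_
      simp only [G, Function.update_of_ne (Finset.ne_of_mem_erase hj)]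
    rw [h2]
    simp only [G, Function.update_self]
    split_ifs <;> simp
  simp only [h1]
  rw [← Fintype.prod_sum]
  rw [Finset.prod_eq_single i]
  · simp [G]
  · intro j _ hj
    simp only [G, Function.update_of_ne hj, hg]
  · simp

lemma aux_prod_dist (r : (∀ i, Fin (d i)) → ℝ) (hr : IsProbDist r) :
    IsProbDist (fun y : ∀ i, Fin (d i) => ∏ i, marginal r i (y i)) := by
  refine ⟨fun y => Finset.prod_nonneg fun i _ => aux_marg_nonneg r hr i _, ?_⟩
  rw [← Fintype.prod_sum]
  simp [aux_marg_sum r hr]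

lemma aux_prod_supp (r : (∀ i, Fin (d i)) → ℝ) (hr : IsProbDist r) (y : ∀ i, Fin (d i))
    (h : ∏ i, marginal r i (y i) = 0) : r y = 0 := by
  obtain ⟨i, _, hi⟩ := Finset.prod_eq_zero_iff.1 h
  unfold marginal at hi
  rw [Finset.sum_eq_zero_iff_of_nonneg
    (fun z _ => by split_ifs; exacts [hr.1 z, le_rfl])] at hi
  simpa using hi y (Finset.mem_univ y)

lemma aux_cross (T : (∀ i, Fin (d i)) → ℝ) (g : ∀ i, Fin (d i) → ℝ)
    (hT : ∀ i, marginal T i = g i) (hs : ∀ y, ∏ i, g i (y i) = 0 → T y = 0) :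
    ∑ y, T y * Real.log (∏ i, g i (y i)) = ∑ i, ∑ b, g i b * Real.log (g i b) := by
  have h1 : ∀ y, T y * Real.log (∏ i, g i (y i)) = ∑ i, T y * Real.log (g i (y i)) := by
    intro y
    by_cases h : ∏ i, g i (y i) = 0
    · simp [hs y h]
    · rw [Real.log_prod (fun i hi => Finset.prod_ne_zero_iff.1 h i hi), Finset.mul_sum]
  simp only [h1]
  rw [Finset.sum_comm]
  refine Finset.sum_congr rfl fun i _ => ?_
  rw [← aux_marg_mul T i (fun b => Real.log (g i b)), hT]

end

/-- If `p, q` are probability distributions that are not permutations of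
each other and `p ⊗ (r₁ ⊗ … ⊗ r_k) ≻ q ⊗ r_{1…k}` for some `k`-partite distribution `r`
with marginals `r₁, …, r_k`, then `rank p ≤ rank q` and `H(p) < H(q)`. -/
theorem c_trumping_necessary {m : ℕ} (p q : Fin m → ℝ)
    (hp : IsProbDist p) (hq : IsProbDist q)
    (hne : ¬ ∃ σ : Equiv.Perm (Fin m), p = q ∘ σ)
    (k : ℕ) (d : Fin k → ℕ) (r : (∀ i, Fin (d i)) → ℝ) (hr : IsProbDist r)
    (hmaj : Majorizes (kron p (fun y : ∀ i, Fin (d i) => ∏ i, marginal r i (y i))) (kron q r)) :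
    distRank p ≤ distRank q ∧ shannonEntropy p < shannonEntropy q := by
  classical
  have hR := aux_prod_dist r hr
  have hsupp := aux_prod_supp r hr
  have hc1 := aux_cross r (marginal r) (fun _ => rfl) hsupp
  have hc2 := aux_cross (fun y : ∀ i, Fin (d i) => ∏ i, marginal r i (y i)) (marginal r)
    (aux_marg_prod _ (aux_marg_sum r hr)) (fun _ h => h)
  have hgib := aux_gibbs r _ hr hR hsupp
  rw [hc1, ← hc2] at hgib
  have hPd := aux_kron_dist p _ hp hR
  have hQd := aux_kron_dist q _ hq hr
  have hP := aux_kron_ent p _ hp hR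
  have hQ := aux_kron_ent q _ hq hr
  have hrank := aux_supp _ _ hPd hQd hmaj
  obtain ⟨hm1, hm2⟩ := aux_maj _ _ hPd hQd hmaj
  rw [hP, hQ] at hm1 hm2
  rw [aux_kron_rank, aux_kron_rank] at hrank
  generalize hRdef : (fun y : ∀ i, Fin (d i) => ∏ i, marginal r i (y i)) = R at *
  have hsupp' : ∀ y, R y = 0 → r y = 0 := by
    intro y hy; rw [← hRdef] at hy; exact hsupp y hy
  have hRent : ∑ y : (∀ i, Fin (d i)), (∏ i, marginal r i (y i)) * Real.log (∏ i, marginal r i (y i))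
      = ∑ y, R y * Real.log (R y) := by rw [← hRdef]
  rw [hRent] at hgib hm1 hm2
  constructor
  · have h1 : distRank r ≤ distRank R := by
      unfold distRank
      refine Finset.card_le_card fun y hy => ?_
      simp only [Finset.mem_filter, Finset.mem_univ, true_and] at hy ⊢
      exact fun h => hy (hsupp' y h)
    have h2 : 0 < distRank R := by
      unfold distRank
      rw [Finset.card_pos]
      by_contra hemp
      rw [Finset.not_nonempty_iff_eq_empty, Finset.filter_eq_empty_iff] at hemp
      have : ∑ y, R y = 0 := Finset.sum_eq_zero fun y hy => by simpa using hemp hy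
      rw [hR.2] at this
      exact one_ne_zero this
    exact Nat.le_of_mul_le_mul_right
      (hrank.trans (Nat.mul_le_mul_left _ h1)) h2
  · unfold shannonEntropy
    by_contra hlt
    have hlt' : ∑ i, p i * Real.log (p i) ≤ ∑ i, q i * Real.log (q i) := by linarith
    have hrR : r = R := hgib.2 (by linarith [hgib.1])
    obtain ⟨σ, hσ⟩ := hm2 (by linarith [hgib.1])
    apply hne
    rw [hrR] at hσ
    apply aux_powers
    intro s
    have hpos : ∑ y, R y ^ s ≠ 0 := by
      intro h0
      rw [Finset.sum_eq_zero_iff_of_nonneg (fun y _ => pow_nonneg (hR.1 y) s)] at h0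
      have : ∑ y, R y = 0 :=
        Finset.sum_eq_zero fun y hy => eq_zero_of_pow_eq_zero (h0 y hy)
      rw [hR.2] at this
      exact one_ne_zero this
    have hk : ∀ a : Fin m → ℝ, ∑ x, kron a R x ^ s = (∑ i, a i ^ s) * ∑ y, R y ^ s := by
      intro a
      simp only [kron, mul_pow, Fintype.sum_prod_type, ← Finset.mul_sum, ← Finset.sum_mul]
    apply mul_right_cancel₀ hpos
    rw [← hk, ← hk, hσ]
    exact Equiv.sum_comp σ (fun x => kron q R x ^ s)
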